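/- arXiv:2307.10552 — 8 statements merged into one kernel-verified Lean document; each statement's English description precedes it below -/
import Mathlib

section
/- Let Z be a common subsequence of X and Y. Then Z is a maximal common subsequence (MCS) of X and Y if and only if for every index k with 0 ≤ k ≤ |Z| there is no match w with pref(Z[1..k]) < w < suff(Z[k+1..|Z|]). -/
open scoped Classical

namespace MCSPaper

variable {α : Type*}

/-- `Z` is a common subsequence of `X` and `Y` (i.e. `X` and `Y` share `Z`). -/
def Shares (X Y Z : List α) : Prop := Z.Sublist X ∧ Z.Sublist Y

/-- `Z` is a maximal common subsequence of `X` and `Y`: it is a common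
subsequence and no single-character insertion yields a common subsequence. -/
def IsMCS (X Y Z : List α) : Prop :=
  Shares X Y Z ∧
    ∀ k, k ≤ Z.length → ∀ c : α, ¬ Shares X Y (Z.take k ++ c :: Z.drop k)

/-- `w = (i, j)` is a match: `1 ≤ i ≤ |X|`, `1 ≤ j ≤ |Y|`, `X[i] = Y[j]`
(1-based indexing). -/
def IsMatch (X Y : List α) (w : ℕ × ℕ) : Prop :=
  1 ≤ w.1 ∧ w.1 ≤ X.length ∧ 1 ≤ w.2 ∧ w.2 ≤ Y.length ∧
    ∃ c : α, X[w.1 - 1]? = some c ∧ Y[w.2 - 1]? = some c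

/-- `c_w = c`, i.e. `X[i_w] = Y[j_w] = c` (1-based indexing). -/
def MatchChar (X Y : List α) (w : ℕ × ℕ) (c : α) : Prop :=
  X[w.1 - 1]? = some c ∧ Y[w.2 - 1]? = some c

/-- `pref(Z)`: componentwise least 1-based indices `(i, j)` such that
`X[1..i]` and `Y[1..j]` contain `Z` as a subsequence; `pref(ε) = (0,0)`. -/
noncomputable def prefPair (X Y Z : List α) : ℕ × ℕ :=
  (sInf {i | Z.Sublist (X.take i)}, sInf {j | Z.Sublist (Y.take j)})

/-- `suff(Z)`: componentwise greatest 1-based indices `(i, j)` such that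
`X[i..|X|]` and `Y[j..|Y|]` contain `Z` as a subsequence;
`suff(ε) = (|X|+1, |Y|+1)`. -/
noncomputable def suffPair (X Y Z : List α) : ℕ × ℕ :=
  (sSup {i | i ≤ X.length + 1 ∧ Z.Sublist (X.drop (i - 1))},
   sSup {j | j ≤ Y.length + 1 ∧ Z.Sublist (Y.drop (j - 1))})

/-- `u < v` componentwise strictly. -/
def pLt (u v : ℕ × ℕ) : Prop := u.1 < v.1 ∧ u.2 < v.2

/-- `u ≤ v` componentwise. -/
def pLe (u v : ℕ × ℕ) : Prop := u.1 ≤ v.1 ∧ u.2 ≤ v.2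

/-- `u ⪇ v`: `u ≤ v` componentwise and `u ≠ v`. -/
def pLneq (u v : ℕ × ℕ) : Prop := pLe u v ∧ u ≠ v

/-- `u ≺ v`: `u < v` and there is no match `w` with `u < w < v`. -/
def pPrec (X Y : List α) (u v : ℕ × ℕ) : Prop :=
  pLt u v ∧ ¬ ∃ w, IsMatch X Y w ∧ pLt u w ∧ pLt w v

/-- `w` is a suff-match: `w = suff(Z)` for some nonempty shared `Z`. -/
def IsSuffMatch (X Y : List α) (w : ℕ × ℕ) : Prop :=
  ∃ Z : List α, Z ≠ [] ∧ Shares X Y Z ∧ suffPair X Y Z = w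

/-- `w` is a pref-match: `w = pref(Z)` for some nonempty shared `Z`. -/
def IsPrefMatch (X Y : List α) (w : ℕ × ℕ) : Prop :=
  ∃ Z : List α, Z ≠ [] ∧ Shares X Y Z ∧ prefPair X Y Z = w

/-- `next_W(c, h)`: least `h'` with `h < h' ≤ |W|` and `W[h'] = c`,
or `|W| + 1` if none (1-based). -/
noncomputable def nextIdx (W : List α) (c : α) (h : ℕ) : ℕ :=
  sInf ({h' | h < h' ∧ W[h' - 1]? = some c} ∪ {W.length + 1})

/-- `prev_W(c, h)`: greatest `h'` with `1 ≤ h' < h` and `W[h'] = c`,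
or `0` if none (1-based). -/
noncomputable def prevIdx (W : List α) (c : α) (h : ℕ) : ℕ :=
  sSup {h' | 1 ≤ h' ∧ h' < h ∧ W[h' - 1]? = some c}

/-- `next(c, w) = (next_X(c, i_w), next_Y(c, j_w))`. -/
noncomputable def nextPair (X Y : List α) (c : α) (w : ℕ × ℕ) : ℕ × ℕ :=
  (nextIdx X c w.1, nextIdx Y c w.2)

/-- `prev(c, w) = (prev_X(c, i_w), prev_Y(c, j_w))`. -/
noncomputable def prevPair (X Y : List α) (c : α) (w : ℕ × ℕ) : ℕ × ℕ :=
  (prevIdx X c w.1, prevIdx Y c w.2)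

/-- `Z'` is a prefix of some MCS of `X` and `Y`. -/
def IsMCSPrefix (X Y Z' : List α) : Prop :=
  ∃ M, IsMCS X Y M ∧ Z' <+: M

/-- `c` is `Z'`-extensible: `Z' ∘ c` is an MCS-prefix. -/
def Extensible (X Y Z' : List α) (c : α) : Prop :=
  IsMCSPrefix X Y (Z' ++ [c])

/-- `Zs` is a single-character insertion derivative of `Z` (shared by `X`, `Y`). -/
def IsDeriv (X Y Z Zs : List α) : Prop :=
  ∃ k, k ≤ Z.length ∧ ∃ c : α, Zs = Z.take k ++ c :: Z.drop k ∧ Shares X Y Zs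

/-- `safe(Z')` as in Conte et al. -/
noncomputable def safePair (X Y Z' : List α) : ℕ × ℕ :=
  (sInf ({i | ∃ Zs, IsDeriv X Y Z' Zs ∧
      prefPair X Y Zs = (i, (prefPair X Y Z').2)} ∪ {X.length + 1}),
   sInf ({j | ∃ Zs, IsDeriv X Y Z' Zs ∧
      prefPair X Y Zs = ((prefPair X Y Z').1, j)} ∪ {Y.length + 1}))

/-- `v` is a `c`-witness of `Z'`-extensibility. -/
def IsCWitness (X Y Z' : List α) (c : α) (v : ℕ × ℕ) : Prop :=
  IsSuffMatch X Y v ∧ pPrec X Y (prefPair X Y Z') v ∧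
    pLe v (safePair X Y Z') ∧ MatchChar X Y v c

/-- `v` is a witness of `Z'`-extensibility. -/
def IsWitness (X Y Z' : List α) (v : ℕ × ℕ) : Prop :=
  ∃ c, IsCWitness X Y Z' c v

/-- `v` is a prominent witness of `Z'`-extensibility. -/
def Prominent (X Y Z' : List α) (v : ℕ × ℕ) : Prop :=
  IsWitness X Y Z' v ∧ ¬ ∃ v', IsWitness X Y Z' v' ∧ pLneq v' v

/-- `Suff_i[j]`: least `i'` with `i ≤ i' ≤ |X|` such that `(i', j)` is a
suff-match, or `|X| + 1` if none. -/
noncomputable def SuffSeq (X Y : List α) (i j : ℕ) : ℕ :=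
  sInf ({i' | i ≤ i' ∧ i' ≤ X.length ∧ IsSuffMatch X Y (i', j)} ∪ {X.length + 1})

/-- `î`: number of indices `i'` with `1 ≤ i' ≤ i` and `X[i'] = c`. -/
def hatI [DecidableEq α] (X : List α) (c : α) (i : ℕ) : ℕ :=
  (X.take i).count c

/-- `ĵ`: number of indices `j'` with `1 ≤ j' ≤ j` and `Y[j'] = c`. -/
def hatJ [DecidableEq α] (Y : List α) (c : α) (j : ℕ) : ℕ :=
  (Y.take j).count c

/-- Sentinel assumptions: `Σ = {1, …, σ}`, `X[1] = Y[1] = 1`,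
`X[|X|] = Y[|Y|] = σ`, and the inner characters lie in `{2, …, σ−1}`. -/
def Sentinel (X Y : List ℕ) (σ : ℕ) : Prop :=
  X ≠ [] ∧ Y ≠ [] ∧ X.head? = some 1 ∧ Y.head? = some 1 ∧
    X.getLast? = some σ ∧ Y.getLast? = some σ ∧
    (∀ c ∈ (X.drop 1).dropLast, 2 ≤ c ∧ c ≤ σ - 1) ∧
    (∀ c ∈ (Y.drop 1).dropLast, 2 ≤ c ∧ c ≤ σ - 1)

/-- Inserting `c` between `A` and `B` yields a subsequence of `W` iff some occurrence of `c` in `W`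
has `A` embedded before it and `B` embedded after it. -/
theorem append_cons_sublist_iff (A B W : List α) (c : α) :
    (A ++ c :: B).Sublist W ↔
      ∃ h, W[h]? = some c ∧ A.Sublist (W.take h) ∧ B.Sublist (W.drop (h + 1)) := by
  constructor
  · intro H
    obtain ⟨W₁, W₂, rfl, hA, hcB⟩ := List.append_sublist_iff.1 H
    obtain ⟨R₁, R₂, rfl, hc, hB⟩ := List.cons_sublist_iff.1 hcB
    obtain ⟨S, T, rfl⟩ := List.append_of_mem hc
    have hW : W₁ ++ (S ++ c :: T ++ R₂) = (W₁ ++ S) ++ c :: (T ++ R₂) := by simp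
    refine ⟨(W₁ ++ S).length, ?_, ?_, ?_⟩
    · rw [hW]; simp
    · rw [hW, List.take_left]
      exact hA.trans (List.sublist_append_left _ _)
    · rw [hW, ← List.drop_drop, List.drop_left]
      exact hB.trans (List.sublist_append_right _ _)
  · rintro ⟨h, hc, hA, hB⟩
    obtain ⟨hlt, rfl⟩ := List.getElem?_eq_some_iff.1 hc
    have H := hA.append (hB.cons_cons W[h])
    rwa [← List.drop_eq_getElem_cons hlt, List.take_append_drop] at H

theorem sInf_take_le_iff {A W : List α} (hA : A.Sublist W) (h : ℕ) :
    sInf {i | A.Sublist (W.take i)} ≤ h ↔ A.Sublist (W.take h) := by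
  constructor
  · intro H
    have hmem : sInf {i | A.Sublist (W.take i)} ∈ {i | A.Sublist (W.take i)} :=
      Nat.sInf_mem ⟨W.length, by simpa using hA⟩
    exact List.Sublist.trans hmem (List.take_sublist_take_left H)
  · intro H
    exact Nat.sInf_le H

theorem le_sSup_drop_iff {B W : List α} (hB : B.Sublist W) {h : ℕ} (hh : h ≤ W.length) :
    h + 1 ≤ sSup {i | i ≤ W.length + 1 ∧ B.Sublist (W.drop (i - 1))} ↔
      B.Sublist (W.drop h) := by
  have hbdd : BddAbove {i | i ≤ W.length + 1 ∧ B.Sublist (W.drop (i - 1))} :=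
    ⟨W.length + 1, fun _ hi => hi.1⟩
  constructor
  · intro H
    have hmem := Nat.sSup_mem (s := {i | i ≤ W.length + 1 ∧ B.Sublist (W.drop (i - 1))})
      ⟨0, by simp, by simpa using hB⟩ hbdd
    exact hmem.2.trans (List.drop_sublist_drop_left W (Nat.le_sub_one_of_lt H))
  · intro H
    exact le_csSup hbdd ⟨by omega, by simpa using H⟩

/-- The one-string form of the correspondence between insertions and matches strictly between
the least prefix position and the greatest suffix position. -/
theorem append_cons_sublist_iff_between {A B W : List α} (hA : A.Sublist W) (hB : B.Sublist W)
    (c : α) :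
    (A ++ c :: B).Sublist W ↔
      ∃ i, 1 ≤ i ∧ i ≤ W.length ∧ W[i - 1]? = some c ∧
        sInf {i | A.Sublist (W.take i)} < i ∧
        i < sSup {i | i ≤ W.length + 1 ∧ B.Sublist (W.drop (i - 1))} := by
  rw [append_cons_sublist_iff]
  constructor
  · rintro ⟨h, hc, h₁, h₂⟩
    have hlt : h < W.length := (List.getElem?_eq_some_iff.1 hc).1
    exact ⟨h + 1, by omega, hlt, hc, Nat.lt_succ_of_le ((sInf_take_le_iff hA h).2 h₁),
      (le_sSup_drop_iff hB hlt).2 h₂⟩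
  · rintro ⟨i, hi, hle, hc, h₁, h₂⟩
    obtain ⟨h, rfl⟩ : ∃ h, i = h + 1 := ⟨i - 1, by omega⟩
    exact ⟨h, hc, (sInf_take_le_iff hA h).1 (Nat.le_of_lt_succ h₁),
      (le_sSup_drop_iff hB hle).1 h₂⟩

/-- Some character can be inserted between `A` and `B` iff there is a match strictly between
`pref(A)` and `suff(B)`. -/
theorem exists_shares_append_cons_iff {X Y A B : List α} (hA : Shares X Y A) (hB : Shares X Y B) :
    (∃ c, Shares X Y (A ++ c :: B)) ↔
      ∃ w, IsMatch X Y w ∧ pLt (prefPair X Y A) w ∧ pLt w (suffPair X Y B) := by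
  simp only [Shares, append_cons_sublist_iff_between hA.1 hB.1,
    append_cons_sublist_iff_between hA.2 hB.2]
  constructor
  · rintro ⟨c, ⟨i, hi, hi', hic, hi₁, hi₂⟩, ⟨j, hj, hj', hjc, hj₁, hj₂⟩⟩
    exact ⟨(i, j), ⟨hi, hi', hj, hj', c, hic, hjc⟩, ⟨hi₁, hj₁⟩, ⟨hi₂, hj₂⟩⟩
  · rintro ⟨⟨i, j⟩, ⟨hi, hi', hj, hj', c, hic, hjc⟩, ⟨hi₁, hj₁⟩, ⟨hi₂, hj₂⟩⟩
    exact ⟨c, ⟨i, hi, hi', hic, hi₁, hi₂⟩, ⟨j, hj, hj', hjc, hj₁, hj₂⟩⟩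

theorem statement0 {α : Type*} (X Y : List α) (hX : X ≠ []) (hY : Y ≠ [])
    (Z : List α) (hZ : Shares X Y Z) :
    IsMCS X Y Z ↔
      ∀ k, k ≤ Z.length →
        ¬ ∃ w, IsMatch X Y w ∧ pLt (prefPair X Y (Z.take k)) w ∧
          pLt w (suffPair X Y (Z.drop k)) := by
  have key (k : ℕ) := exists_shares_append_cons_iff (A := Z.take k) (B := Z.drop k)
    ⟨(List.take_sublist k Z).trans hZ.1, (List.take_sublist k Z).trans hZ.2⟩
    ⟨(List.drop_sublist k Z).trans hZ.1, (List.drop_sublist k Z).trans hZ.2⟩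
  simp only [IsMCS, hZ, true_and, ← key, not_exists]

end MCSPaper
end

section
/- For any strings Z' and Z'' each shared by X and Y, the concatenation Z'∘Z'' is shared by X and Y if and only if pref(Z') < suff(Z''). -/
open scoped Classical

namespace MCSPaper

variable {α : Type*}

/-- A concatenation of two sublists `A`, `B` of `W` is again a sublist of `W` iff the shortest
prefix of `W` containing `A` ends before the shortest suffix of `W` containing `B` begins. -/
theorem append_sublist_iff_sInf_lt_sSup {A B W : List α} (hA : A.Sublist W) (hB : B.Sublist W) :
    (A ++ B).Sublist W ↔
      sInf {i | A.Sublist (W.take i)} <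
        sSup {i | i ≤ W.length + 1 ∧ B.Sublist (W.drop (i - 1))} := by
  have bdd : BddAbove {i | i ≤ W.length + 1 ∧ B.Sublist (W.drop (i - 1))} :=
    ⟨W.length + 1, fun _ hi => hi.1⟩
  constructor
  · intro h
    obtain ⟨r₁, r₂, rfl, hr₁, hr₂⟩ := List.append_sublist_iff.mp h
    have hinf : sInf {i | A.Sublist ((r₁ ++ r₂).take i)} ≤ r₁.length :=
      Nat.sInf_le (by simpa using hr₁)
    have hsup := le_csSup bdd (show r₁.length + 1 ∈ _ from ⟨by simp, by simpa using hr₂⟩)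
    omega
  · intro h
    have hinf : A.Sublist (W.take (sInf {i | A.Sublist (W.take i)})) :=
      Nat.sInf_mem (s := {i | A.Sublist (W.take i)}) ⟨W.length, by simpa using hA⟩
    have hsup := Nat.sSup_mem (s := {i | i ≤ W.length + 1 ∧ B.Sublist (W.drop (i - 1))})
      ⟨1, by simp, by simpa using hB⟩ bdd
    have hdrop := hsup.2.trans (List.drop_sublist_drop_left W (Nat.le_sub_one_of_lt h))
    simpa only [List.take_append_drop] using hinf.append hdrop

theorem statement1 {α : Type*} (X Y : List α) (hX : X ≠ []) (hY : Y ≠ [])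
    (Z' Z'' : List α) (h1 : Shares X Y Z') (h2 : Shares X Y Z'') :
    Shares X Y (Z' ++ Z'') ↔ pLt (prefPair X Y Z') (suffPair X Y Z'') := by
  unfold Shares pLt prefPair suffPair
  rw [← append_sublist_iff_sInf_lt_sSup h1.1 h2.1, ← append_sublist_iff_sInf_lt_sSup h1.2 h2.2]

end MCSPaper
end

section
/- Under the sentinel assumptions, a match w is a suff-match if and only if w = (|X|, |Y|) or there exists a suff-match w' with w = prev(c_w, w'); symmetrically, a match w is a pref-match if and only if w = (1,1) or there exists a pref-match w' with w = next(c_w, w'). -/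
open scoped Classical

namespace MCSPaper

variable {α : Type*}

/-- The first or second component of `suffPair`. -/
noncomputable def suffIdx (W Z : List α) : ℕ :=
  sSup {i | i ≤ W.length + 1 ∧ Z.Sublist (W.drop (i - 1))}

/-- The first or second component of `prefPair`. -/
noncomputable def prefIdx (W Z : List α) : ℕ := sInf {i | Z.Sublist (W.take i)}

theorem cons_sublist_drop_iff (W Z : List α) (c : α) (k : ℕ) :
    (c :: Z).Sublist (W.drop k) ↔
      ∃ h, k ≤ h ∧ W[h]? = some c ∧ Z.Sublist (W.drop (h + 1)) := by
  constructor
  · intro hs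
    obtain ⟨r₁, r₂, hr, hc, hZ⟩ := List.cons_sublist_iff.1 hs
    obtain ⟨n, hn, hnc⟩ := List.getElem_of_mem hc
    have hcn : r₁[n]? = some c := by rw [List.getElem?_eq_getElem hn, hnc]
    refine ⟨k + n, by omega, ?_, ?_⟩
    · rw [← List.getElem?_drop, hr, List.getElem?_append_left hn, hcn]
    · rw [add_assoc, ← List.drop_drop, hr, List.drop_append_of_le_length (by omega)]
      exact hZ.trans (List.sublist_append_right _ _)
  · rintro ⟨h, hkh, hc, hZ⟩
    obtain ⟨hl, rfl⟩ := List.getElem?_eq_some_iff.1 hc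
    have hcons : (W[h] :: Z).Sublist (W.drop h) := by
      rw [List.drop_eq_getElem_cons hl]
      exact hZ.cons_cons _
    exact hcons.trans (List.drop_sublist_drop_left _ hkh)

theorem concat_sublist_take_iff (W Z : List α) (c : α) (k : ℕ) :
    (Z ++ [c]).Sublist (W.take k) ↔
      ∃ h, h < k ∧ W[h]? = some c ∧ Z.Sublist (W.take h) := by
  constructor
  · intro hs
    obtain ⟨r₁, r₂, hr, hZ, hc⟩ := List.append_sublist_iff.1 hs
    obtain ⟨n, hn, hnc⟩ := List.getElem_of_mem (List.singleton_sublist.1 hc)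
    have hlen : r₁.length + n < (W.take k).length := by
      rw [hr, List.length_append]; omega
    have hk : r₁.length + n < k := lt_of_lt_of_le hlen (List.length_take_le _ _)
    refine ⟨r₁.length + n, hk, ?_, ?_⟩
    · rw [← List.getElem?_take_of_lt hk, hr, List.getElem?_append_right (by omega),
        Nat.add_sub_cancel_left, List.getElem?_eq_getElem hn, hnc]
    · have htake : W.take (r₁.length + n) = (W.take k).take (r₁.length + n) := by
        rw [List.take_take, min_eq_left hk.le]
      rw [htake, hr, List.take_append, List.take_of_length_le (by omega)]
      exact hZ.trans (List.sublist_append_left _ _)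
  · rintro ⟨h, hk, hc, hZ⟩
    obtain ⟨hl, rfl⟩ := List.getElem?_eq_some_iff.1 hc
    have hconcat : (Z ++ [W[h]]).Sublist (W.take (h + 1)) := by
      rw [List.take_succ_eq_append_getElem hl]
      exact hZ.append (List.Sublist.refl _)
    exact hconcat.trans (List.take_sublist_take_left hk)

theorem bddAbove_suffIdx_set (W Z : List α) :
    BddAbove {i | i ≤ W.length + 1 ∧ Z.Sublist (W.drop (i - 1))} :=
  ⟨W.length + 1, fun _ h => h.1⟩

theorem bddAbove_prevIdx_set (W : List α) (c : α) (h : ℕ) :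
    BddAbove {h' | 1 ≤ h' ∧ h' < h ∧ W[h' - 1]? = some c} :=
  ⟨h, fun _ hh => hh.2.1.le⟩

theorem succ_le_suffIdx_iff (W Z : List α) (h : ℕ) (hh : h ≤ W.length) :
    h + 1 ≤ suffIdx W Z ↔ Z.Sublist (W.drop h) := by
  constructor
  · intro hle
    have hne : {i | i ≤ W.length + 1 ∧ Z.Sublist (W.drop (i - 1))}.Nonempty := by
      by_contra hemp
      rw [Set.not_nonempty_iff_eq_empty] at hemp
      simp [suffIdx, hemp] at hle
    have hmem : Z.Sublist (W.drop (suffIdx W Z - 1)) :=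
      (Nat.sSup_mem hne (bddAbove_suffIdx_set W Z)).2
    exact hmem.trans (List.drop_sublist_drop_left _ (by omega))
  · intro hZ
    exact le_csSup (bddAbove_suffIdx_set W Z) ⟨by omega, by simpa using hZ⟩

theorem one_le_suffIdx_iff (W Z : List α) : 1 ≤ suffIdx W Z ↔ Z.Sublist W := by
  simpa using succ_le_suffIdx_iff W Z 0 (Nat.zero_le _)

theorem suffIdx_nil (W : List α) : suffIdx W [] = W.length + 1 := by
  apply le_antisymm
  · exact csSup_le ⟨0, by simp⟩ fun _ h => h.1
  · exact (succ_le_suffIdx_iff W [] _ le_rfl).2 (List.nil_sublist _)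

theorem suffIdx_cons (W Z : List α) (c : α) :
    suffIdx W (c :: Z) = prevIdx W c (suffIdx W Z) := by
  refine eq_of_forall_le_iff fun m => ?_
  rcases m with _ | m
  · simp
  constructor
  · intro hm
    have hml : m ≤ W.length := by
      have : suffIdx W (c :: Z) ≤ suffIdx W [] :=
        csSup_le_csSup' (bddAbove_suffIdx_set W _)
          fun i hi => ⟨hi.1, List.nil_sublist _⟩
      rw [suffIdx_nil] at this
      omega
    obtain ⟨h, hmh, hc, hZ⟩ := (cons_sublist_drop_iff W Z c m).1
      ((succ_le_suffIdx_iff W _ m hml).1 hm)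
    have hl := (List.getElem?_eq_some_iff.1 hc).1
    have hlt := (succ_le_suffIdx_iff W Z (h + 1) hl).2 hZ
    exact (Nat.succ_le_succ hmh).trans
      (le_csSup (bddAbove_prevIdx_set W c _) ⟨by omega, by omega, by simpa using hc⟩)
  · intro hm
    have hne : {h' | 1 ≤ h' ∧ h' < suffIdx W Z ∧ W[h' - 1]? = some c}.Nonempty := by
      by_contra hemp
      rw [Set.not_nonempty_iff_eq_empty] at hemp
      simp [prevIdx, hemp] at hm
    obtain ⟨h1, h2, h3⟩ := Nat.sSup_mem hne (bddAbove_prevIdx_set W c _)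
    change 1 ≤ prevIdx W c (suffIdx W Z) at h1
    change prevIdx W c (suffIdx W Z) < _ at h2
    change W[prevIdx W c (suffIdx W Z) - 1]? = _ at h3
    obtain ⟨q, hq⟩ := Nat.exists_eq_add_of_le' h1
    rw [hq] at h2 h3 hm
    have hl := (List.getElem?_eq_some_iff.1 h3).1
    simp only [Nat.add_sub_cancel] at h3 hl
    refine (succ_le_suffIdx_iff W _ m (by omega)).2 ?_
    exact (cons_sublist_drop_iff W Z c m).2
      ⟨q, by omega, h3, (succ_le_suffIdx_iff W Z (q + 1) hl).1 h2⟩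

theorem prefIdx_le_iff {W Z : List α} (hZ : Z.Sublist W) (m : ℕ) :
    prefIdx W Z ≤ m ↔ Z.Sublist (W.take m) := by
  constructor
  · intro hle
    have hmem : Z.Sublist (W.take (prefIdx W Z)) :=
      Nat.sInf_mem (s := {i | Z.Sublist (W.take i)}) ⟨W.length, by simpa using hZ⟩
    exact hmem.trans (List.take_sublist_take_left hle)
  · exact fun h => Nat.sInf_le h

theorem prefIdx_nil (W : List α) : prefIdx W [] = 0 :=
  Nat.le_zero.1 ((prefIdx_le_iff (List.nil_sublist W) 0).2 (List.nil_sublist _))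

theorem nextIdx_le_iff (W : List α) (c : α) (h m : ℕ) (hm : m ≤ W.length) :
    nextIdx W c h ≤ m ↔ ∃ q, q < m ∧ h ≤ q ∧ W[q]? = some c := by
  constructor
  · intro hle
    rcases Nat.sInf_mem (s := {h' | h < h' ∧ W[h' - 1]? = some c} ∪ {W.length + 1})
      ⟨W.length + 1, by simp⟩ with hs | hs
    · change h < nextIdx W c h ∧ W[nextIdx W c h - 1]? = some c at hs
      exact ⟨nextIdx W c h - 1, by omega, by omega, hs.2⟩
    · change nextIdx W c h = W.length + 1 at hs
      omega
  · rintro ⟨q, hqm, hhq, hc⟩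
    exact (Nat.sInf_le (Or.inl ⟨by omega, by simpa using hc⟩) :
      nextIdx W c h ≤ q + 1).trans hqm

theorem concat_sublist_take_iff_nextIdx_le {W Z : List α} (hZ : Z.Sublist W) (c : α) (m : ℕ)
    (hm : m ≤ W.length) :
    (Z ++ [c]).Sublist (W.take m) ↔ nextIdx W c (prefIdx W Z) ≤ m := by
  rw [concat_sublist_take_iff, nextIdx_le_iff _ _ _ _ hm]
  simp only [prefIdx_le_iff hZ]
  exact exists_congr fun _ => by tauto

theorem concat_sublist_of_nextIdx_le {W Z : List α} (hZ : Z.Sublist W) {c : α}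
    (h : nextIdx W c (prefIdx W Z) ≤ W.length) : (Z ++ [c]).Sublist W := by
  simpa using (concat_sublist_take_iff_nextIdx_le hZ c _ le_rfl).2 h

theorem prefIdx_concat {W Z : List α} {c : α} (h : (Z ++ [c]).Sublist W) :
    prefIdx W (Z ++ [c]) = nextIdx W c (prefIdx W Z) := by
  have hZ : Z.Sublist W := (List.sublist_append_left _ _).trans h
  have h1 : prefIdx W (Z ++ [c]) ≤ W.length := (prefIdx_le_iff h _).2 (by simpa using h)
  have h2 : nextIdx W c (prefIdx W Z) ≤ W.length :=
    (concat_sublist_take_iff_nextIdx_le hZ c _ le_rfl).1 (by simpa using h)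
  apply le_antisymm
  · exact (prefIdx_le_iff h _).2 ((concat_sublist_take_iff_nextIdx_le hZ c _ h2).2 le_rfl)
  · exact (concat_sublist_take_iff_nextIdx_le hZ c _ h1).1 ((prefIdx_le_iff h _).1 le_rfl)

theorem suffIdx_singleton_getLast {W : List α} {c : α} (h : W.getLast? = some c) :
    suffIdx W [c] = W.length := by
  rw [List.getLast?_eq_getElem?] at h
  have hl := (List.getElem?_eq_some_iff.1 h).1
  rw [suffIdx_cons, suffIdx_nil]
  apply le_antisymm
  · exact csSup_le' fun i hi => Nat.lt_succ_iff.1 hi.2.1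
  · exact le_csSup (bddAbove_prevIdx_set W c _) ⟨by omega, by omega, h⟩

theorem suffIdx_singleton_of_ne_getLast {W : List α} {c d : α} (h : W.getLast? = some d)
    (hcd : c ≠ d) : suffIdx W [c] = suffIdx W [c, d] := by
  rw [suffIdx_cons W [d], suffIdx_singleton_getLast h, suffIdx_cons, suffIdx_nil]
  rw [List.getLast?_eq_getElem?] at h
  unfold prevIdx
  congr 1
  ext i
  simp only [Set.mem_ofPred_eq]
  refine ⟨fun ⟨h1, h2, h3⟩ => ⟨h1, lt_of_le_of_ne (by omega) ?_, h3⟩,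
    fun ⟨h1, h2, h3⟩ => ⟨h1, by omega, h3⟩⟩
  rintro rfl
  exact hcd (Option.some.inj (h3.symm.trans h))

theorem prefIdx_singleton_head {W : List α} {c : α} (h : W.head? = some c) :
    prefIdx W [c] = 1 := by
  obtain ⟨t, rfl⟩ := List.head?_eq_some_iff.1 h
  have hs : [c].Sublist (c :: t) := by simp
  apply le_antisymm
  · exact (prefIdx_le_iff hs 1).2 (by simp)
  · by_contra hlt
    have := (prefIdx_le_iff hs 0).1 (by omega)
    simp at this

theorem nextIdx_zero_of_ne_head {W : List α} {c d : α} (h : W.head? = some d)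
    (hcd : c ≠ d) : nextIdx W c 0 = nextIdx W c 1 := by
  rw [List.head?_eq_getElem?] at h
  unfold nextIdx
  congr 2
  ext i
  simp only [Set.mem_ofPred_eq]
  refine ⟨fun ⟨h1, h2⟩ => ⟨lt_of_le_of_ne h1 ?_, h2⟩, fun ⟨h1, h2⟩ => ⟨by omega, h2⟩⟩
  rintro rfl
  exact hcd (Option.some.inj (h2.symm.trans h))

theorem suffPair_eq (X Y Z : List α) : suffPair X Y Z = (suffIdx X Z, suffIdx Y Z) := rfl

theorem prefPair_eq (X Y Z : List α) : prefPair X Y Z = (prefIdx X Z, prefIdx Y Z) := rfl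

theorem suffPair_cons (X Y Z : List α) (c : α) :
    suffPair X Y (c :: Z) = prevPair X Y c (suffPair X Y Z) := by
  simp only [suffPair_eq, prevPair, suffIdx_cons]

theorem prefPair_concat {X Y Z : List α} {c : α} (h : Shares X Y (Z ++ [c])) :
    prefPair X Y (Z ++ [c]) = nextPair X Y c (prefPair X Y Z) := by
  simp only [prefPair_eq, nextPair, prefIdx_concat h.1, prefIdx_concat h.2]

theorem shares_iff_suffPair (X Y Z : List α) :
    Shares X Y Z ↔ 1 ≤ (suffPair X Y Z).1 ∧ 1 ≤ (suffPair X Y Z).2 := by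
  simp only [suffPair_eq, one_le_suffIdx_iff, Shares]

theorem matchChar_suffPair_cons {X Y Z : List α} {c : α} (h : Shares X Y (c :: Z)) :
    MatchChar X Y (suffPair X Y (c :: Z)) c := by
  have key : ∀ W : List α, (c :: Z).Sublist W → W[suffIdx W (c :: Z) - 1]? = some c := by
    intro W hW
    have h1 := (one_le_suffIdx_iff W _).2 hW
    rw [suffIdx_cons] at h1 ⊢
    have hne : {h' | 1 ≤ h' ∧ h' < suffIdx W Z ∧ W[h' - 1]? = some c}.Nonempty := by
      by_contra hemp
      rw [Set.not_nonempty_iff_eq_empty] at hemp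
      simp [prevIdx, hemp] at h1
    exact (Nat.sSup_mem hne (bddAbove_prevIdx_set W c _)).2.2
  exact ⟨key X h.1, key Y h.2⟩

theorem matchChar_prefPair_concat {X Y Z : List α} {c : α} (h : Shares X Y (Z ++ [c])) :
    MatchChar X Y (prefPair X Y (Z ++ [c])) c := by
  have key : ∀ W : List α, (Z ++ [c]).Sublist W → W[prefIdx W (Z ++ [c]) - 1]? = some c := by
    intro W hW
    obtain ⟨q, hq, hc, hZ⟩ := (concat_sublist_take_iff W Z c _).1
      ((prefIdx_le_iff hW _).1 le_rfl)
    have hle := (prefIdx_le_iff hW (q + 1)).2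
      ((concat_sublist_take_iff W Z c _).2 ⟨q, q.lt_succ_self, hc, hZ⟩)
    rwa [show prefIdx W (Z ++ [c]) - 1 = q by omega]
  exact ⟨key X h.1, key Y h.2⟩

theorem isSuffMatch_iff {X Y : List α} {d : α} (hX : X.getLast? = some d)
    (hY : Y.getLast? = some d) {w : ℕ × ℕ} (hw : IsMatch X Y w) :
    IsSuffMatch X Y w ↔
      w = (X.length, Y.length) ∨
        ∃ w' c, IsSuffMatch X Y w' ∧ MatchChar X Y w c ∧ w = prevPair X Y c w' := by
  have hd : Shares X Y [d] :=
    ⟨List.singleton_sublist.2 (List.mem_of_getLast? hX),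
      List.singleton_sublist.2 (List.mem_of_getLast? hY)⟩
  have hdw : suffPair X Y [d] = (X.length, Y.length) := by
    rw [suffPair_eq, suffIdx_singleton_getLast hX, suffIdx_singleton_getLast hY]
  constructor
  · rintro ⟨Z, hne, hZ, rfl⟩
    obtain ⟨c, Z', rfl⟩ := List.exists_cons_of_ne_nil hne
    rcases eq_or_ne Z' [] with rfl | hne'
    · rcases eq_or_ne c d with rfl | hcd
      · exact Or.inl hdw
      · refine Or.inr ⟨suffPair X Y [d], c, ⟨[d], by simp, hd, rfl⟩,
          matchChar_suffPair_cons hZ, ?_⟩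
        rw [← suffPair_cons, suffPair_eq, suffPair_eq,
          suffIdx_singleton_of_ne_getLast hX hcd, suffIdx_singleton_of_ne_getLast hY hcd]
    · exact Or.inr ⟨suffPair X Y Z', c,
        ⟨Z', hne', ⟨(List.sublist_cons_self _ _).trans hZ.1,
          (List.sublist_cons_self _ _).trans hZ.2⟩, rfl⟩,
        matchChar_suffPair_cons hZ, suffPair_cons X Y Z' c⟩
  · rintro (rfl | ⟨w', c, ⟨Z, -, -, rfl⟩, -, hwc⟩)
    · exact ⟨[d], by simp, hd, hdw⟩
    · rw [← suffPair_cons] at hwc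
      subst hwc
      exact ⟨c :: Z, by simp, (shares_iff_suffPair X Y _).2 ⟨hw.1, hw.2.2.1⟩, rfl⟩

theorem isPrefMatch_iff {X Y : List α} {d : α} (hX : X.head? = some d)
    (hY : Y.head? = some d) {w : ℕ × ℕ} (hw : IsMatch X Y w) :
    IsPrefMatch X Y w ↔
      w = (1, 1) ∨
        ∃ w' c, IsPrefMatch X Y w' ∧ MatchChar X Y w c ∧ w = nextPair X Y c w' := by
  have hd : Shares X Y [d] :=
    ⟨List.singleton_sublist.2 (List.mem_of_head? hX),
      List.singleton_sublist.2 (List.mem_of_head? hY)⟩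
  have hdw : prefPair X Y [d] = (1, 1) := by
    rw [prefPair_eq, prefIdx_singleton_head hX, prefIdx_singleton_head hY]
  constructor
  · rintro ⟨Z, hne, hZ, rfl⟩
    obtain ⟨Z', c, rfl⟩ := List.eq_nil_or_concat' Z |>.resolve_left hne
    rcases eq_or_ne Z' [] with rfl | hne'
    · rcases eq_or_ne c d with rfl | hcd
      · exact Or.inl hdw
      · refine Or.inr ⟨prefPair X Y [d], c, ⟨[d], by simp, hd, rfl⟩,
          matchChar_prefPair_concat hZ, ?_⟩
        rw [prefPair_concat hZ, hdw]
        simp only [nextPair, prefPair_eq, prefIdx_nil, nextIdx_zero_of_ne_head hX hcd,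
          nextIdx_zero_of_ne_head hY hcd]
    · exact Or.inr ⟨prefPair X Y Z', c,
        ⟨Z', hne', ⟨(List.sublist_append_left _ _).trans hZ.1,
          (List.sublist_append_left _ _).trans hZ.2⟩, rfl⟩,
        matchChar_prefPair_concat hZ, prefPair_concat hZ⟩
  · rintro (rfl | ⟨w', c, ⟨Z, -, hZ, rfl⟩, -, rfl⟩)
    · exact ⟨[d], by simp, hd, hdw⟩
    · have hZc : Shares X Y (Z ++ [c]) :=
        ⟨concat_sublist_of_nextIdx_le hZ.1 hw.2.1,
          concat_sublist_of_nextIdx_le hZ.2 hw.2.2.2.1⟩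
      exact ⟨Z ++ [c], by simp, hZc, prefPair_concat hZc⟩

theorem statement3 (X Y : List ℕ) (σ : ℕ) (hsen : Sentinel X Y σ)
    (w : ℕ × ℕ) (hw : IsMatch X Y w) :
    (IsSuffMatch X Y w ↔
      w = (X.length, Y.length) ∨
        ∃ w' c, IsSuffMatch X Y w' ∧ MatchChar X Y w c ∧
          w = prevPair X Y c w') ∧
    (IsPrefMatch X Y w ↔
      w = (1, 1) ∨
        ∃ w' c, IsPrefMatch X Y w' ∧ MatchChar X Y w c ∧
          w = nextPair X Y c w') := by
  obtain ⟨-, -, hXh, hYh, hXl, hYl, -, -⟩ := hsen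
  exact ⟨isSuffMatch_iff hXl hYl hw, isPrefMatch_iff hXh hYh hw⟩

end MCSPaper
end

section
/- Under the sentinel assumptions, for any nonempty MCS-prefix Z' and any character c, the character c is Z'-extensible if and only if there exists a suff-match v with pref(Z') ≺ v, v ≤ safe(Z'), and c_v = c. -/
open scoped Classical

namespace MCSPaper

variable {α : Type*}

lemma sInf_take_le_iff_s6 {X Z : List α} (h : Z.Sublist X) (i : ℕ) :
    sInf {i | Z.Sublist (X.take i)} ≤ i ↔ Z.Sublist (X.take i) := by
  have hne : {i | Z.Sublist (X.take i)}.Nonempty := ⟨X.length, by simpa using h⟩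
  refine ⟨fun hi => ?_, fun hi => Nat.sInf_le hi⟩
  exact List.Sublist.trans (Nat.sInf_mem hne) (List.take_sublist_take_left hi)

lemma bddAbove_drop (X U : List α) :
    BddAbove {i | i ≤ X.length + 1 ∧ U.Sublist (X.drop (i - 1))} :=
  ⟨X.length + 1, fun _ hi => hi.1⟩

lemma sSup_drop_mem {X U : List α} (h : U.Sublist X) :
    sSup {i | i ≤ X.length + 1 ∧ U.Sublist (X.drop (i - 1))} ∈
      {i | i ≤ X.length + 1 ∧ U.Sublist (X.drop (i - 1))} :=
  Nat.sSup_mem ⟨0, by simpa using h⟩ (bddAbove_drop X U)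

lemma succ_le_sSup_drop_iff {X U : List α} (h : U.Sublist X) (hU : U ≠ []) (i : ℕ) :
    i + 1 ≤ sSup {i | i ≤ X.length + 1 ∧ U.Sublist (X.drop (i - 1))} ↔
      U.Sublist (X.drop i) := by
  constructor
  · intro hi
    exact (sSup_drop_mem h).2.trans (List.drop_sublist_drop_left X (by omega))
  · intro hi
    refine le_csSup (bddAbove_drop X U) ⟨?_, by simpa using hi⟩
    have h1 := hi.length_le
    have h2 := List.length_pos_iff.2 hU
    simp only [List.length_drop] at h1
    omega

/-- A nonempty `U` can follow `Z` inside `X` exactly when the leftmost embedding of `Z` ends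
before the rightmost embedding of `U` starts. -/
lemma append_sublist_iff_sInf_lt_sSup_s6 {X Z U : List α} (hU : U ≠ []) :
    (Z ++ U).Sublist X ↔ Z.Sublist X ∧ U.Sublist X ∧
      sInf {i | Z.Sublist (X.take i)} <
        sSup {i | i ≤ X.length + 1 ∧ U.Sublist (X.drop (i - 1))} := by
  constructor
  · intro h
    obtain ⟨A, B, rfl, hA, hB⟩ := List.append_sublist_iff.1 h
    have hZ := hA.trans (List.sublist_append_left A B)
    have hU' := hB.trans (List.sublist_append_right A B)
    refine ⟨hZ, hU', ?_⟩
    have h1 := (sInf_take_le_iff_s6 hZ A.length).2 (by simpa using hA)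
    have h2 := (succ_le_sSup_drop_iff hU' hU A.length).2 (by simpa using hB)
    omega
  · rintro ⟨hZ, hU', hlt⟩
    have h1 := (sInf_take_le_iff_s6 hZ _).1 le_rfl
    have h2 := (succ_le_sSup_drop_iff hU' hU _).1 hlt
    simpa using h1.append h2

lemma getElem?_sSup_drop {X U : List α} {c : α} (h : (c :: U).Sublist X) :
    X[sSup {i | i ≤ X.length + 1 ∧ (c :: U).Sublist (X.drop (i - 1))} - 1]? = some c := by
  have hpos := (succ_le_sSup_drop_iff h (by simp) 0).2 (by simpa using h)
  obtain ⟨s, hs⟩ : ∃ s, sSup {i | i ≤ X.length + 1 ∧ (c :: U).Sublist (X.drop (i - 1))} = s + 1 :=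
    ⟨_, (Nat.sub_add_cancel hpos).symm⟩
  have h1 := (succ_le_sSup_drop_iff h (by simp) s).1 hs.ge
  have h2 := mt (succ_le_sSup_drop_iff h (by simp) (s + 1)).2 (by omega)
  rw [hs, Nat.add_sub_cancel]
  have hlt : s < X.length := by
    have := h1.length_le
    simp only [List.length_drop, List.length_cons] at this
    omega
  rw [List.drop_eq_getElem_cons hlt] at h1
  rw [List.getElem?_eq_getElem hlt]
  cases h1 with
  | cons _ h => exact absurd h h2
  | cons_cons _ h => rfl

lemma getElem?_sInf_take {X Z : List α} {d : α} (h : (Z ++ [d]).Sublist X) :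
    1 ≤ sInf {i | (Z ++ [d]).Sublist (X.take i)} ∧
      X[sInf {i | (Z ++ [d]).Sublist (X.take i)} - 1]? = some d := by
  have h0 := mt (sInf_take_le_iff_s6 h 0).1 (by simp)
  obtain ⟨s, hs⟩ : ∃ s, sInf {i | (Z ++ [d]).Sublist (X.take i)} = s + 1 :=
    ⟨_, (Nat.sub_add_cancel (by omega)).symm⟩
  have h1 := (sInf_take_le_iff_s6 h (s + 1)).1 hs.le
  have h2 := mt (sInf_take_le_iff_s6 h s).2 (by omega)
  refine ⟨by omega, ?_⟩
  rw [hs, Nat.add_sub_cancel]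
  rw [List.take_add_one] at h1
  obtain ⟨l₁, l₂, he, hl₁, hl₂⟩ := List.sublist_append_iff.1 h1
  rcases hX : X[s]? with _ | a
  · rw [hX] at h1
    exact absurd (by simpa using h1) h2
  · rw [hX] at hl₂
    rcases List.sublist_singleton.1 hl₂ with rfl | rfl
    · rw [List.append_nil] at he
      exact absurd (he ▸ hl₁) h2
    · rw [List.singleton_inj.1 (List.append_inj' he rfl).2]

lemma shares_append_iff {X Y Z U : List α} (hU : U ≠ []) :
    Shares X Y (Z ++ U) ↔ Shares X Y Z ∧ Shares X Y U ∧
      pLt (prefPair X Y Z) (suffPair X Y U) := by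
  unfold Shares pLt prefPair suffPair
  rw [append_sublist_iff_sInf_lt_sSup_s6 hU, append_sublist_iff_sInf_lt_sSup_s6 hU]
  tauto

lemma pLe_suffPair_of_sublist {X Y U V : List α} (hUV : U.Sublist V) (hV : Shares X Y V) :
    pLe (suffPair X Y V) (suffPair X Y U) := by
  constructor
  · have h := sSup_drop_mem hV.1
    exact le_csSup (bddAbove_drop X U) ⟨h.1, hUV.trans h.2⟩
  · have h := sSup_drop_mem hV.2
    exact le_csSup (bddAbove_drop Y U) ⟨h.1, hUV.trans h.2⟩

lemma pLe_prefPair_of_sublist {X Y U V : List α} (hUV : U.Sublist V) (hV : Shares X Y V) :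
    pLe (prefPair X Y U) (prefPair X Y V) :=
  ⟨(sInf_take_le_iff_s6 (hUV.trans hV.1) _).2 (hUV.trans ((sInf_take_le_iff_s6 hV.1 _).1 le_rfl)),
    (sInf_take_le_iff_s6 (hUV.trans hV.2) _).2 (hUV.trans ((sInf_take_le_iff_s6 hV.2 _).1 le_rfl))⟩

lemma matchChar_suffPair {X Y U : List α} {c : α} (h : Shares X Y (c :: U)) :
    MatchChar X Y (suffPair X Y (c :: U)) c :=
  ⟨getElem?_sSup_drop h.1, getElem?_sSup_drop h.2⟩

lemma isMatch_prefPair {X Y Z : List α} (hZ : Z ≠ []) (h : Shares X Y Z) :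
    IsMatch X Y (prefPair X Y Z) := by
  obtain ⟨V, d, rfl⟩ := (List.eq_nil_or_concat' Z).resolve_left hZ
  obtain ⟨hx1, hx⟩ := getElem?_sInf_take h.1
  obtain ⟨hy1, hy⟩ := getElem?_sInf_take h.2
  refine ⟨hx1, ?_, hy1, ?_, d, hx, hy⟩
  · exact (sInf_take_le_iff_s6 h.1 _).2 (by simpa using h.1)
  · exact (sInf_take_le_iff_s6 h.2 _).2 (by simpa using h.2)

lemma take_append_singleton_sublist {X Z : List α} {d : α} {i : ℕ}
    (hZ : Z.Sublist X) (hi : sInf {i | Z.Sublist (X.take i)} < i) (hd : X[i - 1]? = some d) :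
    (Z ++ [d]).Sublist (X.take i) := by
  obtain ⟨s, rfl⟩ : ∃ s, i = s + 1 := ⟨i - 1, by omega⟩
  rw [Nat.add_sub_cancel] at hd
  rw [List.take_add_one, hd]
  exact ((sInf_take_le_iff_s6 hZ s).1 (by omega)).append (List.Sublist.refl _)

/-- A match strictly after `pref(Z)` is weakly after `pref(Z ∘ d)` for its character `d`. -/
lemma exists_append_singleton_of_isMatch {X Y Z : List α} {w : ℕ × ℕ} (hZ : Shares X Y Z)
    (hw : IsMatch X Y w) (hlt : pLt (prefPair X Y Z) w) :
    ∃ d, Shares X Y (Z ++ [d]) ∧ pLe (prefPair X Y (Z ++ [d])) w := by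
  obtain ⟨-, -, -, -, d, hx, hy⟩ := hw
  have h1 := take_append_singleton_sublist hZ.1 hlt.1 hx
  have h2 := take_append_singleton_sublist hZ.2 hlt.2 hy
  have hs : Shares X Y (Z ++ [d]) :=
    ⟨h1.trans (List.take_sublist _ _), h2.trans (List.take_sublist _ _)⟩
  exact ⟨d, hs, (sInf_take_le_iff_s6 hs.1 _).2 h1, (sInf_take_le_iff_s6 hs.2 _).2 h2⟩

lemma isMCS_iff_append {X Y Z : List α} :
    IsMCS X Y Z ↔ Shares X Y Z ∧ ∀ A B d, Z = A ++ B → ¬ Shares X Y (A ++ d :: B) := by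
  refine and_congr_right fun _ => ⟨?_, ?_⟩
  · rintro h A B d rfl
    simpa using h A.length (by simp) d
  · intro h k _ c
    exact h _ _ c (List.take_append_drop k Z).symm

lemma isDeriv_append {X Y A B : List α} {d : α} (h : Shares X Y (A ++ d :: B)) :
    IsDeriv X Y (A ++ B) (A ++ d :: B) :=
  ⟨A.length, by simp, d, by simp, h⟩

/-- Beyond a pair `v` with `pref(Z') ≺ v ≤ safe(Z')`, no insertion into `Z'` can be accommodated. -/
lemma not_pLt_of_isDeriv {X Y Z Zs : List α} {v : ℕ × ℕ} (hprec : pPrec X Y (prefPair X Y Z) v)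
    (hsafe : pLe v (safePair X Y Z)) (hZs : IsDeriv X Y Z Zs) : ¬ pLt (prefPair X Y Zs) v := by
  intro hlt
  have hd := hZs
  obtain ⟨k, -, d, rfl, hs⟩ := hZs
  have hsub : Z.Sublist (Z.take k ++ d :: Z.drop k) := by
    conv_lhs => rw [← List.take_append_drop k Z]
    exact (List.Sublist.refl _).append (List.sublist_cons_self _ _)
  obtain ⟨h1, h2⟩ := pLe_prefPair_of_sublist hsub hs
  rcases h1.eq_or_lt with h1 | h1
  · have : (safePair X Y Z).2 ≤ (prefPair X Y (Z.take k ++ d :: Z.drop k)).2 :=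
      Nat.sInf_le (Or.inl ⟨_, hd, Prod.ext h1.symm rfl⟩)
    exact absurd (hsafe.2.trans this) hlt.2.not_ge
  rcases h2.eq_or_lt with h2 | h2
  · have : (safePair X Y Z).1 ≤ (prefPair X Y (Z.take k ++ d :: Z.drop k)).1 :=
      Nat.sInf_le (Or.inl ⟨_, hd, Prod.ext rfl h2.symm⟩)
    exact absurd (hsafe.1.trans this) hlt.1.not_ge
  · exact hprec.2 ⟨_, isMatch_prefPair (by simp) hs, ⟨h1, h2⟩, hlt⟩

lemma isCWitness_of_isMCS_append_cons {X Y Z W : List α} {c : α} (h : IsMCS X Y (Z ++ c :: W)) :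
    IsCWitness X Y Z c (suffPair X Y (c :: W)) := by
  obtain ⟨hsh, hmax⟩ := isMCS_iff_append.1 h
  have hcW : c :: W ≠ [] := by simp
  obtain ⟨hZ, hU, hlt⟩ := (shares_append_iff hcW).1 hsh
  have hderiv : ∀ Zs, IsDeriv X Y Z Zs → ¬ pLt (prefPair X Y Zs) (suffPair X Y (c :: W)) := by
    rintro _ ⟨k, -, d, rfl, hs⟩ hlt
    refine hmax (Z.take k) (Z.drop k ++ c :: W) d (by simp [← List.append_assoc]) ?_
    simpa using (shares_append_iff hcW).2 ⟨hs, hU, hlt⟩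
  refine ⟨⟨_, hcW, hU, rfl⟩, ⟨hlt, ?_⟩, ⟨?_, ?_⟩, matchChar_suffPair hU⟩
  · rintro ⟨w, hw, hlt1, hlt2⟩
    obtain ⟨d, hs, hle⟩ := exists_append_singleton_of_isMatch hZ hw hlt1
    exact hderiv _ ⟨Z.length, le_rfl, d, by simp, hs⟩
      ⟨hle.1.trans_lt hlt2.1, hle.2.trans_lt hlt2.2⟩
  · refine le_csInf ⟨_, Or.inr rfl⟩ ?_
    rintro i (⟨Zs, hd, hp⟩ | rfl)
    · by_contra hi
      exact hderiv Zs hd (by rw [hp]; exact ⟨not_le.1 hi, hlt.2⟩)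
    · exact (sSup_drop_mem hU.1).1
  · refine le_csInf ⟨_, Or.inr rfl⟩ ?_
    rintro j (⟨Zs, hd, hp⟩ | rfl)
    · by_contra hj
      exact hderiv Zs hd (by rw [hp]; exact ⟨hlt.1, not_le.1 hj⟩)
    · exact (sSup_drop_mem hU.2).1

lemma extensible_of_isCWitness {X Y Z : List α} {c : α} {v : ℕ × ℕ} (hZ : Shares X Y Z)
    (h : IsCWitness X Y Z c v) : Extensible X Y Z c := by
  obtain ⟨⟨U, hU, hUs, rfl⟩, hprec, hsafe, hc⟩ := h
  obtain ⟨a, W, rfl⟩ := List.exists_cons_of_ne_nil hU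
  obtain rfl : a = c := Option.some_injective _ ((matchChar_suffPair hUs).1.symm.trans hc.1)
  let P : ℕ → Prop := fun n => ∃ T : List α, T.length = n ∧ Shares X Y (Z ++ a :: T) ∧
    pLe (suffPair X Y (a :: T)) (suffPair X Y (a :: W))
  have hPW : P W.length :=
    ⟨W, rfl, (shares_append_iff hU).2 ⟨hZ, hUs, hprec.1⟩, le_rfl, le_rfl⟩
  have hbound : ∀ n, P n → n ≤ X.length := by
    rintro _ ⟨T, rfl, hs, -⟩
    have := hs.1.length_le
    simp only [List.length_append, List.length_cons] at this
    omega
  obtain ⟨T, hTlen, hT, hTle⟩ := Nat.findGreatest_spec (P := P) (hbound _ hPW) hPW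
  have hmaxT : ∀ T' : List α, T'.length = T.length + 1 → T.Sublist T' →
      ¬ Shares X Y (Z ++ a :: T') := by
    intro T' hlen hsub hs
    have hle := pLe_suffPair_of_sublist (hsub.cons_cons a)
      ((shares_append_iff (List.cons_ne_nil a T')).1 hs).2.1
    have hP : P (T.length + 1) :=
      ⟨T', hlen, hs, hle.1.trans hTle.1, hle.2.trans hTle.2⟩
    have := Nat.le_findGreatest (hbound _ hP) hP
    omega
  refine ⟨Z ++ a :: T, isMCS_iff_append.2 ⟨hT, ?_⟩, T, by simp⟩
  intro A B d heq hs
  have hleft : ∀ B', Z = A ++ B' → B = B' ++ a :: T → False := by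
    rintro B' rfl rfl
    have hs' : Shares X Y ((A ++ d :: B') ++ a :: T) := by simpa using hs
    obtain ⟨h1, -, hlt⟩ := (shares_append_iff (List.cons_ne_nil a T)).1 hs'
    exact not_pLt_of_isDeriv hprec hsafe (isDeriv_append h1)
      ⟨hlt.1.trans_le hTle.1, hlt.2.trans_le hTle.2⟩
  rcases List.append_eq_append_iff.1 heq with ⟨A', rfl, hA'⟩ | ⟨B', hB', hB⟩
  · cases A' with
    | nil => exact hleft [] (by simp) (by simpa using hA'.symm)
    | cons e A'' =>
      obtain ⟨rfl, rfl⟩ := List.cons_eq_cons.1 hA'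
      refine hmaxT (A'' ++ d :: B) (by simp; omega) ?_ (by simpa using hs)
      exact (List.Sublist.refl _).append (List.sublist_cons_self _ _)
  · exact hleft B' hB' hB

theorem statement6 (X Y : List ℕ) (σ : ℕ) (hsen : Sentinel X Y σ)
    (Z' : List ℕ) (hZ' : Z' ≠ []) (hpre : IsMCSPrefix X Y Z') (c : ℕ) :
    Extensible X Y Z' c ↔
      ∃ v, IsSuffMatch X Y v ∧ pPrec X Y (prefPair X Y Z') v ∧
        pLe v (safePair X Y Z') ∧ MatchChar X Y v c := by
  obtain ⟨M, hM, hZM⟩ := hpre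
  have hZ : Shares X Y Z' := ⟨hZM.sublist.trans hM.1.1, hZM.sublist.trans hM.1.2⟩
  constructor
  · rintro ⟨_, hN, W, rfl⟩
    exact ⟨_, isCWitness_of_isMCS_append_cons (by simpa using hN)⟩
  · rintro ⟨v, hv⟩
    exact extensible_of_isCWitness hZ hv

end MCSPaper
end

section
/- Under the sentinel assumptions, for any nonempty MCS-prefix Z', any character c, and any c-witness v of Z'-extensibility, at least one of i_v = i_{pref(Z'∘c)} and j_v = j_{pref(Z'∘c)} holds (here Z'∘c is shared by X and Y because v witnesses an occurrence of c after pref(Z') in both strings). -/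
open scoped Classical

namespace MCSPaper

variable {α : Type*}

theorem prefix_index_append_singleton {W Z : List α} {c : α} {a : ℕ}
    (hZ : Z.Sublist W) (ha : sInf {i | Z.Sublist (W.take i)} < a) (hc : W[a - 1]? = some c) :
    sInf {i | Z.Sublist (W.take i)} < sInf {i | (Z ++ [c]).Sublist (W.take i)} ∧
      sInf {i | (Z ++ [c]).Sublist (W.take i)} ≤ a ∧
      W[sInf {i | (Z ++ [c]).Sublist (W.take i)} - 1]? = some c := by
  have hp : Z.Sublist (W.take (sInf {i | Z.Sublist (W.take i)})) :=
    Nat.sInf_mem (s := {i | Z.Sublist (W.take i)}) ⟨W.length, by simpa using hZ⟩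
  have hmem : (Z ++ [c]).Sublist (W.take a) := by
    obtain ⟨b, rfl⟩ : ∃ b, a = b + 1 := ⟨a - 1, by omega⟩
    rw [Nat.add_sub_cancel] at hc
    rw [List.take_add_one, hc]
    exact (hp.trans (List.take_sublist_take_left (by omega))).append (List.Sublist.refl _)
  have hq : (Z ++ [c]).Sublist (W.take (sInf {i | (Z ++ [c]).Sublist (W.take i)})) :=
    Nat.sInf_mem (s := {i | (Z ++ [c]).Sublist (W.take i)}) ⟨a, hmem⟩
  have hle : sInf {i | (Z ++ [c]).Sublist (W.take i)} ≤ a := Nat.sInf_le hmem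
  have hmin : ∀ m < sInf {i | (Z ++ [c]).Sublist (W.take i)}, ¬ (Z ++ [c]).Sublist (W.take m) :=
    fun m hm => Nat.notMem_of_lt_sInf hm
  generalize sInf {i | (Z ++ [c]).Sublist (W.take i)} = q at hq hle hmin ⊢
  rcases q with _ | m
  · simp at hq
  have hm := hmin m (Nat.lt_succ_self m)
  rw [List.take_add_one] at hq
  rcases hd : W[m]? with _ | d
  · simp [hd, hm] at hq
  have hr := hq.reverse
  rw [hd] at hr
  simp only [Option.toList_some, List.reverse_append, List.reverse_singleton,
    List.singleton_append] at hr
  rcases List.cons_sublist_cons'.mp hr with h | ⟨rfl, h⟩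
  · exact absurd (by simpa using h.reverse) hm
  · exact ⟨Nat.lt_succ_of_le (Nat.sInf_le (List.reverse_sublist.mp h)), hle, by simpa using hd⟩

theorem statement8 (X Y : List ℕ) (σ : ℕ) (hsen : Sentinel X Y σ)
    (Z' : List ℕ) (hZ' : Z' ≠ []) (hpre : IsMCSPrefix X Y Z') (c : ℕ) (v : ℕ × ℕ)
    (hv : IsCWitness X Y Z' c v) :
    v.1 = (prefPair X Y (Z' ++ [c])).1 ∨ v.2 = (prefPair X Y (Z' ++ [c])).2 := by
  obtain ⟨-, ⟨⟨hlt₁, hlt₂⟩, hno⟩, -, hc₁, hc₂⟩ := hv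
  obtain ⟨M, ⟨⟨hMX, hMY⟩, -⟩, hZM⟩ := hpre
  obtain ⟨hpX, hXle, hX⟩ := prefix_index_append_singleton (hZM.sublist.trans hMX) hlt₁ hc₁
  obtain ⟨hpY, hYle, hY⟩ := prefix_index_append_singleton (hZM.sublist.trans hMY) hlt₂ hc₂
  by_contra! hne
  refine hno ⟨prefPair X Y (Z' ++ [c]), ⟨?_, ?_, ?_, ?_, c, hX, hY⟩, ⟨hpX, hpY⟩,
    lt_of_le_of_ne hXle hne.1.symm, lt_of_le_of_ne hYle hne.2.symm⟩
  · exact Nat.one_le_of_lt hpX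
  · have := (List.getElem?_eq_some_iff.mp hX).1
    simp only [prefPair]
    omega
  · exact Nat.one_le_of_lt hpY
  · have := (List.getElem?_eq_some_iff.mp hY).1
    simp only [prefPair]
    omega

end MCSPaper
end

section
/- Under the sentinel assumptions, for any nonempty MCS-prefix Z' and any character c, there exist at most two prominent c-witnesses of Z'-extensibility. -/
open scoped Classical

namespace MCSPaper

variable {α : Type*}

/-- Among two prominent witnesses, the one further left in `X` is further right in `Y`. -/
theorem Prominent.snd_lt_snd {X Y Z' : List α} {u v : ℕ × ℕ} (hu : Prominent X Y Z' u)
    (hv : Prominent X Y Z' v) (h : u.1 < v.1) : v.2 < u.2 := by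
  by_contra! hle
  exact hv.2 ⟨u, hu.1, ⟨h.le, hle⟩, fun huv => h.ne (congrArg Prod.fst huv)⟩

/-- Prominent witnesses are determined by their first component. -/
theorem Prominent.eq_of_fst_eq {X Y Z' : List α} {u v : ℕ × ℕ} (hu : Prominent X Y Z' u)
    (hv : Prominent X Y Z' v) (h : u.1 = v.1) : u = v := by
  by_contra hne
  rcases le_total u.2 v.2 with hle | hle
  · exact hv.2 ⟨u, hu.1, ⟨h.le, hle⟩, hne⟩
  · exact hu.2 ⟨v, hv.1, ⟨h.ge, hle⟩, Ne.symm hne⟩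

/-- If `u` and `w` are `c`-witnesses strictly to the left of, respectively strictly above, a
`c`-witness `v`, then `(u.1, w.2)` would be a match strictly between `pref(Z')` and `v`. -/
theorem IsCWitness.not_lt_of_lt {X Y Z' : List α} {c : α} {u v w : ℕ × ℕ}
    (hu : IsCWitness X Y Z' c u) (hv : IsCWitness X Y Z' c v) (hw : IsCWitness X Y Z' c w)
    (huv : u.1 < v.1) : ¬ w.2 < v.2 := by
  intro hwv
  obtain ⟨-, ⟨hpu, -⟩, -, hcu, -⟩ := hu
  obtain ⟨-, ⟨hpw, -⟩, -, -, hcw⟩ := hw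
  have h1 := (List.getElem?_eq_some_iff.1 hcu).1
  have h2 := (List.getElem?_eq_some_iff.1 hcw).1
  have h3 := hpu.1
  have h4 := hpw.2
  exact hv.2.1.2 ⟨(u.1, w.2), ⟨by dsimp only; omega, by dsimp only; omega, by dsimp only; omega,
    by dsimp only; omega, c, hcu, hcw⟩, ⟨hpu.1, hpw.2⟩, huv, hwv⟩

/-- Three prominent `c`-witnesses cannot have strictly increasing first components. -/
theorem not_three_prominent_of_fst_lt {X Y Z' : List α} {c : α} {u v w : ℕ × ℕ}
    (hu : IsCWitness X Y Z' c u ∧ Prominent X Y Z' u)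
    (hv : IsCWitness X Y Z' c v ∧ Prominent X Y Z' v)
    (hw : IsCWitness X Y Z' c w ∧ Prominent X Y Z' w) (huv : u.1 < v.1) : ¬ v.1 < w.1 :=
  fun hvw => hu.1.not_lt_of_lt hv.1 hw.1 huv (hv.2.snd_lt_snd hw.2 hvw)

theorem statement9 (X Y : List ℕ) (σ : ℕ) (hsen : Sentinel X Y σ)
    (Z' : List ℕ) (hZ' : Z' ≠ []) (hpre : IsMCSPrefix X Y Z') (c : ℕ) :
    {v : ℕ × ℕ | IsCWitness X Y Z' c v ∧ Prominent X Y Z' v}.encard ≤ 2 := by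
  by_contra! h
  obtain ⟨t, ht, hcard⟩ := Set.exists_subset_encard_eq (Order.add_one_le_of_lt h)
  obtain ⟨u, v, w, huv, huw, hvw, rfl⟩ := Set.encard_eq_three.1 (hcard.trans two_add_one_eq_three)
  have hu := ht (show u ∈ _ by simp)
  have hv := ht (show v ∈ _ by simp)
  have hw := ht (show w ∈ _ by simp)
  have huv' : u.1 ≠ v.1 := fun e => huv (hu.2.eq_of_fst_eq hv.2 e)
  have huw' : u.1 ≠ w.1 := fun e => huw (hu.2.eq_of_fst_eq hw.2 e)
  have hvw' : v.1 ≠ w.1 := fun e => hvw (hv.2.eq_of_fst_eq hw.2 e)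
  have h₁ := not_three_prominent_of_fst_lt hu hv hw
  have h₂ := not_three_prominent_of_fst_lt hu hw hv
  have h₃ := not_three_prominent_of_fst_lt hv hu hw
  have h₄ := not_three_prominent_of_fst_lt hv hw hu
  have h₅ := not_three_prominent_of_fst_lt hw hu hv
  have h₆ := not_three_prominent_of_fst_lt hw hv hu
  omega

end MCSPaper
end

section
/- Under the sentinel assumptions, for any nonempty MCS-prefix Z' and any Z'-extensible character c, the number of Z'-extensible characters is strictly less than a_{pref(Z'∘c)} − a_{pref(Z')}, where a_{(i,j)} = i + j. -/
open scoped Classical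

namespace MCSPaper

variable {α : Type*}

/-- The least length of a prefix of `W` containing `Z` as a subsequence. -/
noncomputable def prefLength (W Z : List α) : ℕ := sInf {i | Z.Sublist (W.take i)}

theorem prefLength_le {W Z : List α} {i : ℕ} (h : Z.Sublist (W.take i)) :
    prefLength W Z ≤ i := Nat.sInf_le h

theorem sublist_take_prefLength {W Z : List α} (h : Z.Sublist W) :
    Z.Sublist (W.take (prefLength W Z)) :=
  Nat.sInf_mem (s := {i | Z.Sublist (W.take i)}) ⟨W.length, by simpa using h⟩

theorem sublist_drop_prefLength {W Z T : List α} (h : (Z ++ T).Sublist W) :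
    T.Sublist (W.drop (prefLength W Z)) := by
  obtain ⟨A, B, rfl, hA, hB⟩ := List.append_sublist_iff.mp h
  have hle : prefLength (A ++ B) Z ≤ A.length := prefLength_le (by simpa using hA)
  have hdrop := List.drop_sublist_drop_left (A ++ B) hle
  rw [List.drop_left] at hdrop
  exact hB.trans hdrop

theorem prefLength_lt_append_singleton {W Z : List α} {c : α} (h : (Z ++ [c]).Sublist W) :
    prefLength W Z < prefLength W (Z ++ [c]) := by
  obtain ⟨A, B, hW, hA, hB⟩ := List.append_sublist_iff.mp (sublist_take_prefLength h)
  have hlen := congrArg List.length hW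
  have hBlen := hB.length_le
  simp only [List.length_take, List.length_append, List.length_singleton] at hlen hBlen
  have hle : prefLength W Z ≤ A.length := by
    apply prefLength_le
    have hAW : A <+: W := (hW ▸ List.prefix_append A B).trans (List.take_prefix _ _)
    rwa [← List.prefix_iff_eq_take.mp hAW]
  omega

theorem take_prefLength_append_singleton {W Z : List α} {c : α} (h : (Z ++ [c]).Sublist W) :
    W.take (prefLength W (Z ++ [c])) = W.take (prefLength W (Z ++ [c]) - 1) ++ [c] := by
  have hs := sublist_take_prefLength h
  have hpos := prefLength_lt_append_singleton h
  obtain ⟨n, hn⟩ : ∃ n, prefLength W (Z ++ [c]) = n + 1 :=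
    ⟨prefLength W (Z ++ [c]) - 1, by omega⟩
  have hmin : ¬ (Z ++ [c]).Sublist (W.take n) := fun hcon => by
    have := prefLength_le hcon
    omega
  rw [hn] at hs ⊢
  rw [List.take_add_one] at hs ⊢
  rw [Nat.add_sub_cancel]
  rcases hw : W[n]? with _ | w
  · simp only [hw, Option.toList_none, List.append_nil] at hs
    exact absurd hs hmin
  · simp only [hw, Option.toList_some] at hs ⊢
    obtain ⟨A, B, hAB, hA, hB⟩ := List.sublist_append_iff.mp hs
    rcases List.sublist_singleton.mp hB with rfl | rfl
    · rw [List.append_nil] at hAB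
      exact absurd (hAB ▸ hA) hmin
    · rw [(List.append_inj' hAB rfl).2]

theorem cons_sublist_of_notMem_left {b : α} {T L R : List α} (hb : b ∉ L)
    (h : (b :: T).Sublist (L ++ R)) : (b :: T).Sublist R := by
  induction L with
  | nil => exact h
  | cons a L ih =>
    rw [List.mem_cons, not_or] at hb
    rcases h with h | h
    · exact ih hb.2 (by assumption)
    · exact absurd rfl hb.1

/-- If `b` does not occur strictly between the positions of `pref(Z)` and `pref(Z ∘ c)` in `W`,
then `c` can be inserted before `b`. -/
theorem insert_sublist_of_notMem {W Z T : List α} {b c : α} (hc : (Z ++ [c]).Sublist W)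
    (hb : (Z ++ b :: T).Sublist W) (hbc : b ≠ c)
    (hmem : b ∉ (W.take (prefLength W (Z ++ [c]) - 1)).drop (prefLength W Z)) :
    (Z ++ c :: b :: T).Sublist W := by
  have hlt := prefLength_lt_append_singleton hc
  have htake := take_prefLength_append_singleton hc
  have hdrop := sublist_drop_prefLength hb
  have hsplit : W.drop (prefLength W Z) =
      (W.take (prefLength W (Z ++ [c]))).drop (prefLength W Z) ++
        W.drop (prefLength W (Z ++ [c])) := by
    have := List.take_append_drop (prefLength W (Z ++ [c]) - prefLength W Z)
      (W.drop (prefLength W Z))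
    rw [List.drop_drop, Nat.add_sub_of_le hlt.le] at this
    rw [List.drop_take, this]
  have hnot : b ∉ (W.take (prefLength W (Z ++ [c]))).drop (prefLength W Z) := by
    rw [htake, List.drop_append, List.mem_append, not_or]
    exact ⟨hmem, fun h => hbc (List.mem_singleton.mp (List.mem_of_mem_drop h))⟩
  rw [hsplit] at hdrop
  have := (sublist_take_prefLength hc).append (cons_sublist_of_notMem_left hnot hdrop)
  rwa [List.take_append_drop, List.append_assoc] at this

theorem Extensible.shares {X Y Z : List α} {c : α} (h : Extensible X Y Z c) :
    Shares X Y (Z ++ [c]) := by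
  obtain ⟨M, hM, hpre⟩ := h
  exact ⟨hpre.sublist.trans hM.1.1, hpre.sublist.trans hM.1.2⟩

/-- Two distinct extensible characters cannot be nested strictly in both strings. -/
theorem Extensible.mem_or_mem {X Y Z : List α} {b c : α} (hb : Extensible X Y Z b)
    (hc : Shares X Y (Z ++ [c])) (hbc : b ≠ c) :
    b ∈ (X.take (prefLength X (Z ++ [c]) - 1)).drop (prefLength X Z) ∨
      b ∈ (Y.take (prefLength Y (Z ++ [c]) - 1)).drop (prefLength Y Z) := by
  by_contra! hnot
  obtain ⟨M, ⟨hM, hmax⟩, T, rfl⟩ := hb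
  rw [List.append_assoc, List.singleton_append] at hM hmax
  apply hmax Z.length (by simp) c
  rw [List.take_left, List.drop_left]
  exact ⟨insert_sublist_of_notMem hc.1 hM.1 hbc hnot.1,
    insert_sublist_of_notMem hc.2 hM.2 hbc hnot.2⟩

theorem statement11 (X Y : List ℕ) (σ : ℕ) (hsen : Sentinel X Y σ)
    (Z' : List ℕ) (hZ' : Z' ≠ []) (hpre : IsMCSPrefix X Y Z') (c : ℕ)
    (hc : Extensible X Y Z' c) :
    {b : ℕ | Extensible X Y Z' b}.encard <
      (((prefPair X Y (Z' ++ [c])).1 + (prefPair X Y (Z' ++ [c])).2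
        - ((prefPair X Y Z').1 + (prefPair X Y Z').2) : ℕ) : ℕ∞) := by
  have hsh := hc.shares
  have hX := prefLength_lt_append_singleton hsh.1
  have hY := prefLength_lt_append_singleton hsh.2
  change _ < ((prefLength X (Z' ++ [c]) + prefLength Y (Z' ++ [c])
    - (prefLength X Z' + prefLength Y Z') : ℕ) : ℕ∞)
  set A := (X.take (prefLength X (Z' ++ [c]) - 1)).drop (prefLength X Z') with hA
  set B := (Y.take (prefLength Y (Z' ++ [c]) - 1)).drop (prefLength Y Z') with hB
  have hAlen : A.length ≤ prefLength X (Z' ++ [c]) - 1 - prefLength X Z' := by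
    simp only [hA, List.length_drop, List.length_take]
    omega
  have hBlen : B.length ≤ prefLength Y (Z' ++ [c]) - 1 - prefLength Y Z' := by
    simp only [hB, List.length_drop, List.length_take]
    omega
  have hsub : {b : ℕ | Extensible X Y Z' b} ⊆ ((c :: (A ++ B)).toFinset : Set ℕ) := by
    intro b hb
    simp only [List.coe_toFinset, Set.mem_ofPred_eq, List.mem_cons, List.mem_append]
    by_cases hbc : b = c
    · exact Or.inl hbc
    · exact Or.inr (Extensible.mem_or_mem hb hsh hbc)
  refine (Set.encard_le_encard hsub).trans_lt ?_
  rw [Set.encard_coe_eq_coe_finsetCard, Nat.cast_lt]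
  refine (List.toFinset_card_le _).trans_lt ?_
  rw [List.length_cons, List.length_append]
  omega

end MCSPaper
end

section
/- Under the sentinel assumptions, let Z' be a nonempty MCS-prefix and let i = i_{pref(Z')} + 1. Define indices j_1 > j_2 > ⋯ as follows: j_1 is the least index attaining the minimum of Suff_i[j] over j_{pref(Z')} + 1 ≤ j ≤ min(j_{safe(Z')}, |Y|) (provided this range is nonempty), and for r ≥ 2, j_r is the least index attaining the minimum of Suff_i[j] over j_{pref(Z')} + 1 ≤ j ≤ j_{r−1} − 1, as long as this range is nonempty. Let ℓ be the number of terms j_r of this (finite) sequence with Suff_i[j_r] ≤ min(i_{safe(Z')}, |X|). Then the set of prominent witnesses of Z'-extensibility is exactly { (Suff_i[j_r], j_r) : 1 ≤ r ≤ ℓ }. -/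
open scoped Classical

namespace MCSPaper

variable {α : Type*}

/-- The least index in the window `[lo, hi]` attaining the minimum of
`Suff_i` over the window. -/
noncomputable def argminJ (X Y : List ℕ) (i lo hi : ℕ) : ℕ :=
  sInf {j | lo ≤ j ∧ j ≤ hi ∧
    ∀ j', lo ≤ j' → j' ≤ hi → SuffSeq X Y i j ≤ SuffSeq X Y i j'}

/-- The sequence `j_1 > j_2 > ⋯` of Lemma 7: `jseq … 0` is a dummy value
`hi1 + 1`, and `jseq … (r+1)` is the least minimizer of `Suff_i` over
`[lo, jseq … r − 1]`. -/
noncomputable def jseq (X Y : List ℕ) (i lo hi1 : ℕ) : ℕ → ℕ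
  | 0 => hi1 + 1
  | r + 1 => argminJ X Y i lo (jseq X Y i lo hi1 r - 1)

theorem suffIdx_isGreatest {W Z : List α} (h : Z.Sublist W) :
    IsGreatest {i | i ≤ W.length + 1 ∧ Z.Sublist (W.drop (i - 1))} (suffIdx W Z) := by
  have hb : BddAbove {i | i ≤ W.length + 1 ∧ Z.Sublist (W.drop (i - 1))} :=
    ⟨W.length + 1, fun i hi => hi.1⟩
  exact ⟨Nat.sSup_mem ⟨0, by simpa using h⟩ hb, fun i hi => le_csSup hb hi⟩

theorem one_le_suffIdx {W Z : List α} (h : Z.Sublist W) : 1 ≤ suffIdx W Z :=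
  (suffIdx_isGreatest h).2 ⟨by omega, by simpa using h⟩

theorem suffIdx_cons_le_length {W Z : List α} {c : α} (h : (c :: Z).Sublist W) :
    suffIdx W (c :: Z) ≤ W.length := by
  have h1 := (suffIdx_isGreatest h).1.2.length_le
  have h2 := one_le_suffIdx h
  simp only [List.length_cons, List.length_drop] at h1
  omega

theorem getElem?_suffIdx_cons {W Z : List α} {c : α} (h : (c :: Z).Sublist W) :
    W[suffIdx W (c :: Z) - 1]? = some c := by
  have hg := suffIdx_isGreatest h
  have h1 := one_le_suffIdx h
  have h2 := suffIdx_cons_le_length h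
  have hlt : suffIdx W (c :: Z) - 1 < W.length := by omega
  have hs := hg.1.2
  rw [List.drop_eq_getElem_cons hlt, List.cons_sublist_cons'] at hs
  rw [List.getElem?_eq_getElem hlt]
  rcases hs with hs | hs
  · have : suffIdx W (c :: Z) + 1 ≤ suffIdx W (c :: Z) := hg.2
      ⟨by omega, by rwa [show suffIdx W (c :: Z) + 1 - 1 = suffIdx W (c :: Z) - 1 + 1 by omega]⟩
    omega
  · exact congrArg some hs.1.symm

theorem cons_sublist_drop {W Z : List α} {c : α} {k : ℕ} (h : Z.Sublist W) (hk : 1 ≤ k)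
    (hlt : k < suffIdx W Z) (hc : W[k - 1]? = some c) : (c :: Z).Sublist (W.drop (k - 1)) := by
  obtain ⟨hl, he⟩ := List.getElem?_eq_some_iff.1 hc
  rw [List.drop_eq_getElem_cons hl, he]
  refine List.Sublist.cons_cons c ((suffIdx_isGreatest h).1.2.trans ?_)
  exact List.drop_sublist_drop_left W (by omega)

theorem le_suffIdx_cons {W Z : List α} {c : α} {k : ℕ} (h : Z.Sublist W) (hk : 1 ≤ k)
    (hlt : k < suffIdx W Z) (hc : W[k - 1]? = some c) : k ≤ suffIdx W (c :: Z) := by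
  have hs := cons_sublist_drop h hk hlt hc
  have := (suffIdx_isGreatest h).1.1
  exact (suffIdx_isGreatest (hs.trans (List.drop_sublist _ _))).2 ⟨by omega, hs⟩

theorem suffIdx_cons_lt {W Z : List α} {c : α} (h : (c :: Z).Sublist W) :
    suffIdx W (c :: Z) < suffIdx W Z := by
  have h1 := one_le_suffIdx h
  have h2 := suffIdx_cons_le_length h
  have hs := (suffIdx_isGreatest h).1.2.tail
  rw [List.tail_cons, List.tail_drop] at hs
  exact (suffIdx_isGreatest ((List.sublist_cons_self c Z).trans h)).2
    ⟨by omega, by rwa [show suffIdx W (c :: Z) + 1 - 1 = suffIdx W (c :: Z) - 1 + 1 by omega]⟩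

theorem IsSuffMatch.isMatch {X Y : List α} {v : ℕ × ℕ} (h : IsSuffMatch X Y v) :
    IsMatch X Y v := by
  obtain ⟨Z, hZ, ⟨hX, hY⟩, rfl⟩ := h
  obtain ⟨c, Z, rfl⟩ := List.exists_cons_of_ne_nil hZ
  exact ⟨one_le_suffIdx hX, suffIdx_cons_le_length hX, one_le_suffIdx hY,
    suffIdx_cons_le_length hY, c, getElem?_suffIdx_cons hX, getElem?_suffIdx_cons hY⟩

/-- Between a match and a larger suff-match lies another suff-match. -/
theorem IsSuffMatch.exists_between {X Y : List α} {v w : ℕ × ℕ} (hv : IsSuffMatch X Y v)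
    (hw : IsMatch X Y w) (hwv : pLt w v) : ∃ u, IsSuffMatch X Y u ∧ pLe w u ∧ pLt u v := by
  obtain ⟨Z, -, ⟨hX, hY⟩, rfl⟩ := hv
  obtain ⟨hw1, -, hw2, -, c, hcX, hcY⟩ := hw
  have hX' := (cons_sublist_drop hX hw1 hwv.1 hcX).trans (List.drop_sublist _ _)
  have hYc := (cons_sublist_drop hY hw2 hwv.2 hcY).trans (List.drop_sublist _ _)
  exact ⟨suffPair X Y (c :: Z), ⟨_, by simp, ⟨hX', hYc⟩, rfl⟩,
    ⟨le_suffIdx_cons hX hw1 hwv.1 hcX, le_suffIdx_cons hY hw2 hwv.2 hcY⟩,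
    suffIdx_cons_lt hX', suffIdx_cons_lt hYc⟩

/-- A suff-match in the box bounded by `pref(Z')` and `safe(Z')`. -/
def InBox (X Y Z' : List α) (v : ℕ × ℕ) : Prop :=
  IsSuffMatch X Y v ∧ pLt (prefPair X Y Z') v ∧ pLe v (safePair X Y Z')

theorem IsWitness.inBox {X Y Z' : List α} {v : ℕ × ℕ} (h : IsWitness X Y Z' v) :
    InBox X Y Z' v := by
  obtain ⟨c, h1, h2, h3, -⟩ := h
  exact ⟨h1, h2.1, h3⟩

theorem InBox.exists_isWitness_le {X Y Z' : List α} {v : ℕ × ℕ} (hv : InBox X Y Z' v) :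
    ∃ u, IsWitness X Y Z' u ∧ pLe u v := by
  induction hn : v.1 using Nat.strong_induction_on generalizing v with
  | _ n ih =>
    obtain ⟨hs, hp, hle⟩ := hv
    by_cases hw : ∃ w, IsMatch X Y w ∧ pLt (prefPair X Y Z') w ∧ pLt w v
    · obtain ⟨w, hw, hpw, hwv⟩ := hw
      obtain ⟨u, hu, hwu, huv⟩ := hs.exists_between hw hwv
      obtain ⟨t, ht, htu⟩ := ih u.1 (hn ▸ huv.1) (v := u)
        ⟨hu, ⟨hpw.1.trans_le hwu.1, hpw.2.trans_le hwu.2⟩,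
          huv.1.le.trans hle.1, huv.2.le.trans hle.2⟩ rfl
      exact ⟨t, ht, htu.1.trans huv.1.le, htu.2.trans huv.2.le⟩
    · obtain ⟨-, -, -, -, c, hc⟩ := hs.isMatch
      exact ⟨v, ⟨c, hs, ⟨hp, hw⟩, hle, hc⟩, le_rfl, le_rfl⟩

theorem pLe.antisymm {u v : ℕ × ℕ} (h : pLe u v) (huv : pLe v u) : u = v :=
  Prod.ext (h.1.antisymm huv.1) (h.2.antisymm huv.2)

theorem pLe.trans {u v w : ℕ × ℕ} (h : pLe u v) (huv : pLe v w) : pLe u w :=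
  ⟨h.1.trans huv.1, h.2.trans huv.2⟩

/-- Prominent witnesses are the minimal suff-matches of the box. -/
theorem prominent_iff {X Y Z' : List α} {v : ℕ × ℕ} :
    Prominent X Y Z' v ↔ InBox X Y Z' v ∧ ∀ u, InBox X Y Z' u → pLe u v → u = v := by
  constructor
  · rintro ⟨hv, hmin⟩
    refine ⟨hv.inBox, fun u hu huv => ?_⟩
    obtain ⟨t, ht, htu⟩ := hu.exists_isWitness_le
    have htv : t = v := by
      by_contra hne
      exact hmin ⟨t, ht, htu.trans huv, hne⟩
    exact huv.antisymm (htv ▸ htu)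
  · rintro ⟨hv, hmin⟩
    obtain ⟨t, ht, htv⟩ := hv.exists_isWitness_le
    refine ⟨hmin t ht.inBox htv ▸ ht, ?_⟩
    rintro ⟨u, hu, huv, hne⟩
    exact hne (hmin u hu.inBox huv)

theorem SuffSeq_le {X Y : List α} {i : ℕ} {v : ℕ × ℕ} (h : i ≤ v.1) (hv : IsSuffMatch X Y v) :
    SuffSeq X Y i v.2 ≤ v.1 :=
  Nat.sInf_le (Or.inl ⟨h, hv.isMatch.2.1, hv⟩)

theorem SuffSeq_spec {X Y : List α} {i j : ℕ} (h : SuffSeq X Y i j ≤ X.length) :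
    i ≤ SuffSeq X Y i j ∧ IsSuffMatch X Y (SuffSeq X Y i j, j) := by
  have hmem := Nat.sInf_mem (s := {i' | i ≤ i' ∧ i' ≤ X.length ∧ IsSuffMatch X Y (i', j)} ∪
    {X.length + 1}) ⟨_, Or.inr rfl⟩
  rcases hmem with hmem | hmem
  · exact ⟨hmem.1, hmem.2.2⟩
  · have : SuffSeq X Y i j = X.length + 1 := hmem
    omega

theorem argminJ_mem (X Y : List ℕ) (i : ℕ) {lo hi : ℕ} (h : lo ≤ hi) :
    argminJ X Y i lo hi ∈ {j | lo ≤ j ∧ j ≤ hi ∧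
      ∀ j', lo ≤ j' → j' ≤ hi → SuffSeq X Y i j ≤ SuffSeq X Y i j'} := by
  apply Nat.sInf_mem
  obtain ⟨j, hj, hmin⟩ := (Finset.Icc lo hi).exists_min_image (SuffSeq X Y i)
    ⟨lo, Finset.mem_Icc.2 ⟨le_rfl, h⟩⟩
  rw [Finset.mem_Icc] at hj
  exact ⟨j, hj.1, hj.2, fun j' h1 h2 => hmin j' (Finset.mem_Icc.2 ⟨h1, h2⟩)⟩

theorem argminJ_le_of_le {X Y : List ℕ} {i lo hi j : ℕ} (h1 : lo ≤ j) (h2 : j ≤ hi)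
    (h : SuffSeq X Y i j ≤ SuffSeq X Y i (argminJ X Y i lo hi)) : argminJ X Y i lo hi ≤ j :=
  Nat.sInf_le ⟨h1, h2, fun k hlo hhi =>
    h.trans ((argminJ_mem X Y i (h1.trans h2)).2.2 k hlo hhi)⟩

/-- Every window position `j` lies between two consecutive terms of the sequence. -/
theorem exists_jseq_le_lt (X Y : List ℕ) (i : ℕ) {lo hi1 j : ℕ} (hlo : 1 ≤ lo) (h1 : lo ≤ j)
    (h2 : j ≤ hi1) : ∃ r, jseq X Y i lo hi1 (r + 1) ≤ j ∧
      ∀ s, s ≤ r → j ≤ jseq X Y i lo hi1 s - 1 := by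
  have hex : ∃ r, jseq X Y i lo hi1 r ≤ j := by
    by_contra! hcon
    have key : ∀ r, jseq X Y i lo hi1 r + r ≤ hi1 + 1 := by
      intro r
      induction r with
      | zero => simp [jseq]
      | succ r ih =>
        have hr := hcon r
        have := (argminJ_mem X Y i (lo := lo) (hi := jseq X Y i lo hi1 r - 1) (by omega)).2.1
        simp only [jseq]
        omega
    have := key (hi1 + 2)
    omega
  have hpos : Nat.find hex ≠ 0 := by
    intro h0
    have := Nat.find_spec hex
    rw [h0] at this
    simp only [jseq] at this
    omega
  obtain ⟨r, hr⟩ := Nat.exists_eq_succ_of_ne_zero hpos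
  have hspec := Nat.find_spec hex
  rw [hr] at hspec
  refine ⟨r, hspec, fun s hs => ?_⟩
  have := Nat.find_min hex (m := s) (by omega)
  omega

theorem statement12 (X Y : List ℕ) (σ : ℕ) (hsen : Sentinel X Y σ)
    (Z' : List ℕ) (hZ' : Z' ≠ []) (hpre : IsMCSPrefix X Y Z')
    (i lo hi1 : ℕ)
    (hi : i = (prefPair X Y Z').1 + 1)
    (hlo : lo = (prefPair X Y Z').2 + 1)
    (hhi1 : hi1 = min (safePair X Y Z').2 Y.length) :
    {v : ℕ × ℕ | Prominent X Y Z' v} =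
      {v : ℕ × ℕ | ∃ r, 1 ≤ r ∧
        (∀ s, 1 ≤ s → s ≤ r → lo ≤ jseq X Y i lo hi1 (s - 1) - 1) ∧
        SuffSeq X Y i (jseq X Y i lo hi1 r) ≤ min (safePair X Y Z').1 X.length ∧
        v = (SuffSeq X Y i (jseq X Y i lo hi1 r), jseq X Y i lo hi1 r)} := by
  have hbox : ∀ j, lo ≤ j → j ≤ hi1 →
      SuffSeq X Y i j ≤ min (safePair X Y Z').1 X.length →
      InBox X Y Z' (SuffSeq X Y i j, j) := by
    intro j h1 h2 h3
    obtain ⟨h4, h5⟩ := SuffSeq_spec (h3.trans (min_le_right _ _))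
    refine ⟨h5, ⟨?_, ?_⟩, h3.trans (min_le_left _ _), h2.trans (hhi1 ▸ min_le_left _ _)⟩
    · change (prefPair X Y Z').1 < SuffSeq X Y i j
      omega
    · change (prefPair X Y Z').2 < j
      omega
  ext v
  simp only [Set.mem_ofPred_eq, prominent_iff]
  constructor
  · rintro ⟨hv, hmin⟩
    obtain ⟨hs, hp, hle⟩ := hv
    have hm := hs.isMatch
    have hiv : i ≤ v.1 := hi ▸ hp.1
    have hlov : lo ≤ v.2 := hlo ▸ hp.2
    obtain ⟨r, hr, hwin⟩ := exists_jseq_le_lt X Y i (by omega) hlov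
      (hhi1 ▸ le_min hle.2 hm.2.2.2.1)
    obtain ⟨hlor, -, hrmin⟩ := argminJ_mem X Y i (hlov.trans (hwin r le_rfl))
    have hSv := (hrmin v.2 hlov (hwin r le_rfl)).trans (SuffSeq_le hiv hs)
    have hS := hSv.trans (le_min hle.1 hm.2.1)
    refine ⟨r + 1, by omega, fun s _ hsr => hlov.trans (hwin (s - 1) (by omega)), hS, ?_⟩
    exact (hmin _ (hbox _ hlor (hr.trans (hhi1 ▸ le_min hle.2 hm.2.2.2.1)) hS) ⟨hSv, hr⟩).symm
  · rintro ⟨r, hr, hwin, hS, rfl⟩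
    obtain ⟨r, rfl⟩ := Nat.exists_eq_succ_of_ne_zero (by omega : r ≠ 0)
    have hle : ∀ s, s ≤ r → jseq X Y i lo hi1 s ≤ hi1 + 1 := by
      intro s
      induction s with
      | zero => simp [jseq]
      | succ s ih =>
        intro hs
        have h1 := ih (by omega)
        have h2 := (argminJ_mem X Y i (hwin (s + 1) (by omega) (by omega))).2.1
        simp only [Nat.add_sub_cancel] at h2
        simp only [jseq]
        omega
    have hw := hwin (r + 1) (by omega) le_rfl
    obtain ⟨h1, h2, -⟩ := argminJ_mem X Y i hw
    simp only [Nat.add_sub_cancel] at h1 h2 hw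
    have hler := hle r le_rfl
    refine ⟨hbox _ h1 (h2.trans (by omega)) hS, fun u hu hule => ?_⟩
    have hlou : lo ≤ u.2 := hlo ▸ hu.2.1.2
    have hSu := SuffSeq_le (X := X) (Y := Y) (i := i) (hi ▸ hu.2.1.1) hu.1
    refine hule.antisymm ⟨?_, argminJ_le_of_le hlou (hule.2.trans h2) (hSu.trans hule.1)⟩
    exact ((argminJ_mem X Y i hw).2.2 u.2 hlou (hule.2.trans h2)).trans hSu

end MCSPaper
end
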